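/- Every 2-connected K_{2,4}-minor-free graph has a hamilton path. -/

import Mathlib

namespace K24Paper

open SimpleGraph

/-- `H` is a minor of `G`: branch sets indexed by vertices of `H`, pairwise disjoint,
each inducing a connected subgraph of `G`, with every edge of `H` realized by an edge
of `G` between the corresponding branch sets. -/
def IsMinor {W V : Type*} (H : SimpleGraph W) (G : SimpleGraph V) : Prop :=
  ∃ B : W → Set V,
    (∀ w, (G.induce (B w)).Connected) ∧
    (∀ w₁ w₂, w₁ ≠ w₂ → Disjoint (B w₁) (B w₂)) ∧
    (∀ w₁ w₂, H.Adj w₁ w₂ → ∃ v₁ ∈ B w₁, ∃ v₂ ∈ B w₂, G.Adj v₁ v₂)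

/-- `G` is `H`-minor-free. -/
def MinorFree {W V : Type*} (H : SimpleGraph W) (G : SimpleGraph V) : Prop :=
  ¬ IsMinor H G

/-- The complete bipartite graph `K_{2,4}`. -/
def K24 : SimpleGraph (Fin 2 ⊕ Fin 4) := completeBipartiteGraph (Fin 2) (Fin 4)

/-- `G` is `k`-connected: more than `k` vertices, and removing fewer than `k`
vertices leaves a connected graph. -/
def KConnected {V : Type*} (k : ℕ) (G : SimpleGraph V) : Prop :=
  k < Nat.card V ∧ ∀ S : Set V, S.ncard < k → (G.induce Sᶜ).Connected

/-- The graph `G_{n,r,s}` (with the plus edge if `plus = true`), on vertices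
`0, …, n-1` corresponding to `v_1, …, v_n`:  the spine `v_1 v_2 ⋯ v_n`, the edges
`v_1 v_{n-i}` for `1 ≤ i ≤ r`, the edges `v_n v_{1+j}` for `1 ≤ j ≤ s`, and
(if `plus`) the plus edge `v_1 v_n`. -/
def Gnrs (n r s : ℕ) (plus : Bool) : SimpleGraph (Fin n) :=
  SimpleGraph.fromRel (fun a b =>
    b.val = a.val + 1 ∨
    (a.val = 0 ∧ n - 1 - r ≤ b.val ∧ b.val ≤ n - 2) ∨
    (b.val = n - 1 ∧ 1 ≤ a.val ∧ a.val ≤ s) ∨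
    (plus = true ∧ a.val = 0 ∧ b.val = n - 1))

/-- The parameter conditions describing membership in the class `𝒢`. -/
def Gparams (n r s : ℕ) (plus : Bool) : Prop :=
  (plus = true ∧ 4 ≤ n ∧ ((r = 1 ∧ s = n - 3) ∨ (r = n - 3 ∧ s = 1))) ∨
  (5 ≤ n ∧ 2 ≤ r ∧ r ≤ n - 3 ∧ 2 ≤ s ∧ s ≤ n - 3 ∧ (r + s = n - 2 ∨ r + s = n - 1))

/-- `G` belongs to `𝒢̃`, i.e. `G` is isomorphic to a graph of the class `𝒢`. -/
def InGtilde {V : Type*} (G : SimpleGraph V) : Prop :=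
  ∃ n r s plus, Gparams n r s plus ∧ Nonempty (G ≃g Gnrs n r s plus)

/-- The graph obtained from `G` by subdividing every edge in `F` once:
new vertices are the members of `F`. -/
def SubdivideEdges {V : Type*} (G : SimpleGraph V) (F : Set (Sym2 V)) :
    SimpleGraph (V ⊕ F) :=
  SimpleGraph.fromRel (fun a b =>
    match a, b with
    | Sum.inl u, Sum.inl v => G.Adj u v ∧ s(u, v) ∉ F
    | Sum.inl u, Sum.inr e => u ∈ (e : Sym2 V)
    | Sum.inr e, Sum.inl u => u ∈ (e : Sym2 V)
    | Sum.inr _, Sum.inr _ => False)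

/-- A set `F` of edges of a graph `G` is subdividable if subdividing every edge
of `F` once yields a `K_{2,4}`-minor-free graph. -/
def Subdividable {V : Type*} (G : SimpleGraph V) (F : Set (Sym2 V)) : Prop :=
  F ⊆ G.edgeSet ∧ MinorFree K24 (SubdivideEdges G F)

/-- `F` is a maximal subdividable set of edges of `G`. -/
def MaxSubdividable {V : Type*} (G : SimpleGraph V) (F : Set (Sym2 V)) : Prop :=
  Subdividable G F ∧ ∀ F', Subdividable G F' → F ⊆ F' → F' = F

/-- `l` lists vertices along a path of `G` (consecutive entries adjacent, no repeats)
such that no two edges of `G` cross with respect to this ordering. -/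
def OuterListing {U : Type*} (G : SimpleGraph U) (l : List U) : Prop :=
  l.Nodup ∧ l.Chain' G.Adj ∧
  ∀ (i k j m : ℕ) (h1 : i < k) (h2 : k < j) (h3 : j < m) (hm : m < l.length),
    ¬(G.Adj (l.get ⟨i, by omega⟩) (l.get ⟨j, by omega⟩) ∧
      G.Adj (l.get ⟨k, by omega⟩) (l.get ⟨m, by omega⟩))

/-- The graph `G` restricted to the vertex set `A` is `xy`-outerplanar: it has a
hamilton `xy`-path (listing exactly the vertices of `A`) such that no two edges
cross with respect to it. -/
def XYOuterplanar {U : Type*} (G : SimpleGraph U) (A : Set U) (x y : U) : Prop :=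
  ∃ l : List U, (∀ v, v ∈ l ↔ v ∈ A) ∧ l.head? = some x ∧ l.getLast? = some y ∧
    OuterListing G l

/-- A block: a connected graph with no cutvertex. -/
def IsBlock {V : Type*} (G : SimpleGraph V) : Prop :=
  G.Connected ∧ ∀ v : V, (G.induce {u | u ≠ v}).Preconnected

/-- `G + xy`: the graph `G` with the edge `xy` added (if not already present). -/
def AddEdge {U : Type*} (G : SimpleGraph U) (x y : U) : SimpleGraph U :=
  G ⊔ SimpleGraph.fromRel (fun a b => a = x ∧ b = y)

/-- A standard `K_{2,t}` minor `(R₁, R₂; S)` of `G`. -/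
def StdK2tMinor {V : Type*} (G : SimpleGraph V) (t : ℕ) (R₁ R₂ S : Set V) : Prop :=
  Disjoint R₁ R₂ ∧ Disjoint (R₁ ∪ R₂) S ∧
  (G.induce R₁).Connected ∧ (G.induce R₂).Connected ∧
  S.Finite ∧ S.ncard = t ∧
  ∀ v ∈ S, (∃ w ∈ R₁, G.Adj v w) ∧ (∃ w ∈ R₂, G.Adj v w)

/-- `K_{3,3}` with parts `{0,1,2}` and `{3,4,5}`. -/
def K33 : SimpleGraph (Fin 6) :=
  SimpleGraph.fromRel (fun a b => a.val < 3 ∧ 3 ≤ b.val)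

/-- The graph `A = K_{3,3} + v₂v₃`. -/
def GA : SimpleGraph (Fin 6) := AddEdge K33 1 2

/-- The graph `A⁺ = K_{3,3} + v₂v₃ + v₅v₆`. -/
def GAplus : SimpleGraph (Fin 6) := AddEdge GA 4 5

/-- The graph `B`, on vertices `h, r₁, r₂, r₃, r₄, g₁, g₂ = 0, …, 6`. -/
def GB : SimpleGraph (Fin 7) :=
  SimpleGraph.fromRel (fun a b => (a.val, b.val) ∈
    [(0,3),(0,4),(1,4),(2,3),(3,4),(5,0),(5,1),(5,2),(6,0),(6,1),(6,2)])

/-- The graph `B⁺ = B + g₁g₂`. -/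
def GBplus : SimpleGraph (Fin 7) := AddEdge GB 5 6

/-- The graph `C⁺`, on vertices `v₁, …, v₈ = 0, …, 7`. -/
def GCplus : SimpleGraph (Fin 8) :=
  SimpleGraph.fromRel (fun a b => (a.val, b.val) ∈
    [(0,1),(0,2),(1,2),(3,4),(3,5),(3,6),(3,7),(4,5),(4,6),(4,7),(2,5),(1,7),(0,6)])

/-- The graph `C = C⁺ ∖ v₄v₅`. -/
def GC : SimpleGraph (Fin 8) := GCplus.deleteEdges {s(3, 4)}

/-- The graph `D`, on vertices `t₁, t₂, t₃, d₁, d₂, d₃, g = 0, …, 6`. -/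
def GD : SimpleGraph (Fin 7) :=
  SimpleGraph.fromRel (fun a b => (a.val, b.val) ∈
    [(0,1),(0,2),(1,2),(3,4),(3,5),(4,5),(0,3),(1,4),(2,5),(6,0),(6,1),(6,2)])

/-- The complete graph `K₅`. -/
def GK5 : SimpleGraph (Fin 5) := completeGraph (Fin 5)

end K24Paper

namespace K24Paper

open SimpleGraph

section Aux

variable {V : Type*} {G : SimpleGraph V}

/-- The list `a, L, b` is a chain of adjacent vertices. -/
def J (G : SimpleGraph V) (a : V) (L : List V) (b : V) : Prop :=
  List.IsChain G.Adj (a :: (L ++ [b]))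

lemma chain_rev {l : List V} (h : List.IsChain G.Adj l) : List.IsChain G.Adj l.reverse := by
  rw [List.isChain_reverse]
  exact h.imp (fun a b hab => hab.symm)

lemma J.rev {a b : V} {L : List V} (h : J G a L b) : J G b L.reverse a := by
  have := chain_rev h
  simpa [J] using this

lemma J.glue {a b m : V} {L L' : List V} (h : J G a L m) (h' : J G m L' b) :
    J G a (L ++ m :: L') b := by
  have := (List.isChain_split (R := G.Adj) (c := m) (l₁ := a :: L) (l₂ := L' ++ [b])).2
    ⟨by simpa [J] using h, by simpa [J] using h'⟩
  simpa [J] using this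

lemma J.split {a b m : V} {L L' : List V} (h : J G a (L ++ m :: L') b) :
    J G a L m ∧ J G m L' b := by
  have := (List.isChain_split (R := G.Adj) (c := m) (l₁ := a :: L) (l₂ := L' ++ [b])).1
    (by simpa [J] using h)
  simpa [J] using this

lemma J.adj {a b : V} (h : J G a [] b) : G.Adj a b := by
  simpa [J] using h

lemma J.inner {a b : V} {L : List V} (h : J G a L b) : List.IsChain G.Adj L := by
  have h1 : List.IsChain G.Adj (L ++ [b]) := List.IsChain.tail h
  exact h1.left_of_append

lemma J.first {a b : V} {L : List V} (h : J G a L b) (hL : L ≠ []) : ∃ c ∈ L, G.Adj a c := by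
  cases L with
  | nil => exact absurd rfl hL
  | cons c t =>
    refine ⟨c, by simp, ?_⟩
    simp [J] at h
    exact h.1

lemma J.last {a b : V} {L : List V} (h : J G a L b) (hL : L ≠ []) : ∃ c ∈ L, G.Adj b c := by
  obtain ⟨c, hc, hb⟩ := h.rev.first (by simpa using hL)
  exact ⟨c, by simpa using hc, hb⟩

lemma exists_walk {l : List V} (h : List.IsChain G.Adj l) (hl : l ≠ []) :
    ∃ (u v : V) (p : G.Walk u v), p.support = l := by
  induction l with
  | nil => exact absurd rfl hl
  | cons a t ih =>
    cases t with
    | nil => exact ⟨a, a, .nil, rfl⟩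
    | cons b t =>
      obtain ⟨u, v, p, hp⟩ := ih h.tail (by simp)
      have hu : u = b := by
        have := p.cons_tail_support
        rw [hp] at this
        simpa using this
      subst hu
      have hab : G.Adj a u := by
        simp at h
        exact h.1
      exact ⟨a, v, .cons hab p, by simp [hp]⟩

lemma list_connected {l : List V} (h : List.IsChain G.Adj l) (hl : l ≠ []) :
    (G.induce {v | v ∈ l}).Connected := by
  obtain ⟨u, v, p, hp⟩ := exists_walk h hl
  subst hp
  exact p.connected_induce_support

lemma nodup_of_count [DecidableEq V] {l l' : List V} (h : l.Nodup)
    (hc : ∀ a, l'.count a ≤ l.count a) : l'.Nodup := by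
  rw [List.nodup_iff_count_le_one] at h ⊢
  exact fun a => (hc a).trans (h a)

/-- Building a `K_{2,4}` minor out of lists. -/
lemma minor_of_lists {R₁ R₂ : List V} {S : Fin 4 → List V} {a b : Fin 4 → V}
    (hR₁ : List.IsChain G.Adj R₁) (hR₂ : List.IsChain G.Adj R₂)
    (ha : ∀ i, a i ∈ R₁) (hb : ∀ i, b i ∈ R₂) (hne : ∀ i, S i ≠ [])
    (hS : ∀ i, J G (a i) (S i) (b i))
    (hnd : (R₁ ++ (R₂ ++ (S 0 ++ (S 1 ++ (S 2 ++ S 3))))).Nodup) : IsMinor K24 G := by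
  have hR₁' : R₁ ≠ [] := List.ne_nil_of_mem (ha 0)
  have hR₂' : R₂ ≠ [] := List.ne_nil_of_mem (hb 0)
  simp only [List.nodup_append, List.mem_append] at hnd
  refine ⟨Sum.elim (fun i => if i = 0 then {v | v ∈ R₁} else {v | v ∈ R₂})
    (fun i => {v | v ∈ S i}), ?_, ?_, ?_⟩
  · rintro (i | i)
    · fin_cases i
      · exact list_connected hR₁ hR₁'
      · exact list_connected hR₂ hR₂'
    · exact list_connected (hS i).inner (hne i)
  · rintro (i | i) (j | j) hij
    · fin_cases i <;> fin_cases j <;> simp at hij <;>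
        simp [Set.disjoint_left] <;> grind
    · fin_cases i <;> fin_cases j <;> simp [Set.disjoint_left] <;> grind
    · fin_cases i <;> fin_cases j <;> simp [Set.disjoint_left] <;> grind
    · fin_cases i <;> fin_cases j <;> simp at hij <;>
        simp [Set.disjoint_left] <;> grind
  · have key : ∀ (i : Fin 2) (j : Fin 4),
        ∃ v₁ ∈ (if i = 0 then {v | v ∈ R₁} else {v | v ∈ R₂} : Set V), ∃ v₂ ∈ S j,
          G.Adj v₁ v₂ := by
      intro i j
      fin_cases i
      · exact ⟨a j, ha j, (hS j).first (hne j)⟩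
      · exact ⟨b j, hb j, (hS j).last (hne j)⟩
    rintro (i | i) (j | j) hij
    · simp [K24] at hij
    · exact key i j
    · obtain ⟨v₁, h₁, v₂, h₂, h⟩ := key j i
      exact ⟨v₂, h₂, v₁, h₁, h.symm⟩
    · simp [K24] at hij

/-- A closed chain `a, t, a`. -/
def Cyc (G : SimpleGraph V) (a : V) (t : List V) : Prop :=
  J G a t a ∧ (a :: t).Nodup

/-- A theta graph with three paths with nonempty interiors. -/
structure Theta (G : SimpleGraph V) (x y : V) (A B C : List V) : Prop where
  hA : J G x A y
  hB : J G x B y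
  hC : J G x C y
  nA : A ≠ []
  nB : B ≠ []
  nC : C ≠ []
  nd : (x :: y :: (A ++ (B ++ C))).Nodup

/-- `n` is the order of a cycle or a theta graph in `G`. -/
def Good (G : SimpleGraph V) (n : ℕ) : Prop :=
  (∃ a t, Cyc G a t ∧ n = t.length + 1) ∨
  (∃ x y A B C, Theta G x y A B C ∧ n = A.length + B.length + C.length + 2)

/-- An ear attached to the vertices of the list `l`. -/
structure Ear (G : SimpleGraph V) (l : List V) (u v : V) (L : List V) : Prop where
  path : J G u L v
  ne : L ≠ []
  nd : L.Nodup
  dis : ∀ a ∈ L, a ∉ l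
  huv : u ≠ v

lemma Ear.symm {l L : List V} {u v : V} (h : Ear G l u v L) : Ear G l v u L.reverse :=
  ⟨h.path.rev, by simpa using h.ne, by simpa using h.nd, by simpa using h.dis, h.huv.symm⟩

lemma Ear.nodup {l L : List V} {u v : V} (h : Ear G l u v L) (hl : l.Nodup) :
    (L ++ l).Nodup := by
  rw [List.nodup_append]
  exact ⟨h.nd, hl, fun a ha b hb hab => h.dis a ha (hab ▸ hb)⟩

lemma Ear.congr {l l' L : List V} {u v : V} (h : Ear G l u v L) (hl : ∀ a ∈ l', a ∈ l) :
    Ear G l' u v L :=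
  ⟨h.path, h.ne, h.nd, fun a ha hal => h.dis a ha (hl a hal), h.huv⟩

lemma Cyc.rotate [DecidableEq V] {a u : V} {s t : List V} (h : Cyc G a (s ++ u :: t)) :
    Cyc G u (t ++ a :: s) :=
  ⟨(h.1.split.2).glue h.1.split.1, nodup_of_count h.2 (by
    intro b
    simp only [List.count_append, List.count_cons]
    omega)⟩

lemma cyc_step [DecidableEq V] {a v : V} {t L : List V} (h : Cyc G a t)
    (e : Ear G (a :: t) a v L) (hv : v ∈ t) : ∃ m > t.length + 1, Good G m := by
  obtain ⟨M, N, rfl⟩ := List.append_of_mem hv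
  have hL : 0 < L.length := List.length_pos_iff.2 e.ne
  have hn := e.nodup h.2
  by_cases hM : M = []
  · subst hM
    refine ⟨_, ?_, Or.inl ⟨a, L ++ v :: N, ⟨e.path.glue h.1.split.2, nodup_of_count hn ?_⟩, rfl⟩⟩
    · simp; omega
    · intro b
      simp only [List.count_append, List.count_cons, List.count_nil]
      omega
  by_cases hN : N = []
  · subst hN
    refine ⟨_, ?_, Or.inl ⟨a, M ++ v :: L.reverse,
      ⟨h.1.split.1.glue e.path.rev, nodup_of_count hn ?_⟩, rfl⟩⟩
    · simp; omega
    · intro b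
      simp only [List.count_append, List.count_cons, List.count_nil, List.count_reverse]
      omega
  refine ⟨_, ?_, Or.inr ⟨a, v, M, L, N.reverse, ⟨h.1.split.1, e.path, h.1.split.2.rev, hM, e.ne,
    by simpa using hN, nodup_of_count hn ?_⟩, rfl⟩⟩
  · simp; omega
  · intro b
    simp only [List.count_append, List.count_cons, List.count_reverse]
    omega

lemma Theta.swapAB [DecidableEq V] {x y : V} {A B C : List V} (h : Theta G x y A B C) :
    Theta G x y B A C :=
  ⟨h.hB, h.hA, h.hC, h.nB, h.nA, h.nC, nodup_of_count h.nd (by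
    intro b
    simp only [List.count_append, List.count_cons]
    omega)⟩

lemma Theta.swapBC [DecidableEq V] {x y : V} {A B C : List V} (h : Theta G x y A B C) :
    Theta G x y A C B :=
  ⟨h.hA, h.hC, h.hB, h.nA, h.nC, h.nB, nodup_of_count h.nd (by
    intro b
    simp only [List.count_append, List.count_cons]
    omega)⟩

lemma Theta.flip [DecidableEq V] {x y : V} {A B C : List V} (h : Theta G x y A B C) :
    Theta G y x A.reverse B.reverse C.reverse :=
  ⟨h.hA.rev, h.hB.rev, h.hC.rev, by simpa using h.nA, by simpa using h.nB, by simpa using h.nC,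
    nodup_of_count h.nd (by
    intro b
    simp only [List.count_append, List.count_cons, List.count_reverse]
    omega)⟩

/-- The outcome of attaching an ear to a good subgraph. -/
def Outcome (G : SimpleGraph V) (n : ℕ) : Prop := (∃ m > n, Good G m) ∨ IsMinor K24 G

lemma exists_middle {x y : V} {A P R : List V} (L : List V) (hP : P ≠ []) (hR : R ≠ [])
    (h : x :: (A ++ [y]) = P ++ R) : ∃ A', x :: (A' ++ [y]) = P ++ (L ++ R) := by
  obtain ⟨p, P', rfl⟩ := List.exists_cons_of_ne_nil hP
  have hR' := List.dropLast_concat_getLast hR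
  rw [← hR'] at h ⊢
  simp only [List.cons_append, List.cons.injEq] at h
  obtain ⟨rfl, h⟩ := h
  rw [← List.append_assoc] at h
  obtain ⟨-, h⟩ := List.append_inj' h rfl
  simp only [List.cons.injEq, and_true] at h
  refine ⟨P' ++ (L ++ R.dropLast), ?_⟩
  rw [← h]
  simp

lemma case_same [DecidableEq V] {x y u v : V} {A B C L Q₀ M Q₁ : List V}
    (h : Theta G x y A B C)
    (e : Ear G (x :: y :: (A ++ (B ++ C))) u v L)
    (hd : x :: (A ++ [y]) = (Q₀ ++ [u]) ++ (M ++ v :: Q₁)) :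
    Outcome G (A.length + B.length + C.length + 2) := by
  have hL : 0 < L.length := List.length_pos_iff.2 e.ne
  have hn := e.nodup h.nd
  have hch : List.IsChain G.Adj (x :: (A ++ [y])) := h.hA
  have hcount : ∀ b, List.count b (x :: (A ++ [y])) = List.count b ((Q₀ ++ [u]) ++ (M ++ v :: Q₁)) :=
    fun b => by rw [hd]
  have hlen := congrArg List.length hd
  simp only [List.count_append, List.count_cons, List.count_nil] at hcount
  simp only [List.length_append, List.length_cons, List.length_nil] at hlen
  have hc1 : List.IsChain G.Adj (Q₀ ++ [u]) := by
    rw [hd] at hch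
    exact hch.left_of_append
  have hc2 : J G u M v ∧ List.IsChain G.Adj (v :: Q₁) := by
    rw [hd] at hch
    have h1 : List.IsChain G.Adj ((u :: M) ++ v :: Q₁) := by
      have : (Q₀ ++ [u]) ++ (M ++ v :: Q₁) = Q₀ ++ ((u :: M) ++ v :: Q₁) := by simp
      rw [this] at hch
      exact hch.right_of_append
    rw [List.isChain_split] at h1
    exact ⟨by simpa [J] using h1.1, h1.2⟩
  by_cases hM : M = []
  · subst hM
    obtain ⟨A', hA'⟩ := exists_middle L (by simp) (by simp) hd
    have hlen' := congrArg List.length hA'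
    have hcount' : ∀ b, List.count b (x :: (A' ++ [y])) =
      List.count b ((Q₀ ++ [u]) ++ (L ++ ([] ++ v :: Q₁))) := fun b => by rw [hA']
    simp only [List.count_append, List.count_cons, List.count_nil] at hcount'
    simp only [List.length_append, List.length_cons, List.length_nil] at hlen'
    refine Or.inl ⟨A'.length + B.length + C.length + 2, ?_, Or.inr ⟨x, y, A', B, C,
      ⟨?_, h.hB, h.hC, ?_, h.nB, h.nC, nodup_of_count hn ?_⟩, rfl⟩⟩
    · simp at hlen; omega
    · have h1 : List.IsChain G.Adj (Q₀ ++ u :: (L ++ v :: Q₁)) := by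
        rw [List.isChain_split]
        refine ⟨hc1, ?_⟩
        have h2 : List.IsChain G.Adj ((u :: L) ++ v :: Q₁) := by
          rw [List.isChain_split]
          exact ⟨by simpa [J] using e.path, hc2.2⟩
        simpa using h2
      unfold J
      rw [hA']
      simpa using h1
    · rintro rfl
      simp at hlen'
      simp at hlen
      have := h.nA
      have : 0 < A.length := List.length_pos_iff.2 h.nA
      omega
    · intro b
      have h1 := hcount b
      have h2 := hcount' b
      simp only [List.count_append, List.count_cons]
      omega
  · right
    have hx : x ∈ Q₀ ++ [u] := by
      cases Q₀ with
      | nil => simp at hd; simp [hd.1]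
      | cons q Q => simp at hd; simp [hd.1]
    have hy : y ∈ v :: Q₁ := by
      have h1 := congrArg List.getLast? hd
      have h2 : (x :: (A ++ [y])).getLast? = some y := by
        rw [← List.cons_append, List.getLast?_concat]
      have h3 : ((Q₀ ++ [u]) ++ (M ++ v :: Q₁)).getLast? = (v :: Q₁).getLast? := by
        rw [← List.append_assoc, List.getLast?_append_of_ne_nil]
        simp
      rw [h2, h3] at h1
      exact List.mem_of_getLast? h1.symm
    refine minor_of_lists (R₁ := Q₀ ++ [u]) (R₂ := v :: Q₁) (S := ![M, L, B, C])
      (a := ![u, u, x, x]) (b := ![v, v, y, y]) hc1 hc2.2 ?_ ?_ ?_ ?_ (nodup_of_count hn ?_)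
    · intro i; fin_cases i <;> simp <;> simpa using hx
    · intro i; fin_cases i <;> simp <;> simpa using hy
    · intro i; fin_cases i <;> simp [hM, e.ne, h.nB, h.nC]
    · intro i; fin_cases i <;> simp [hc2.1, e.path, h.hB, h.hC]
    · intro b
      have h1 := hcount b
      simp [List.count_cons, -List.cons_append] at h1 ⊢
      omega

lemma split_two {l : List V} {u v : V} (hu : u ∈ l) (hv : v ∈ l) (huv : u ≠ v) :
    (∃ Q₀ M Q₁, l = (Q₀ ++ [u]) ++ (M ++ v :: Q₁)) ∨
    (∃ Q₀ M Q₁, l = (Q₀ ++ [v]) ++ (M ++ u :: Q₁)) := by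
  obtain ⟨s, t, rfl⟩ := List.append_of_mem hu
  simp only [List.mem_append, List.mem_cons] at hv
  rcases hv with hv | hv | hv
  · right
    obtain ⟨s1, s2, rfl⟩ := List.append_of_mem hv
    exact ⟨s1, s2, t, by simp⟩
  · exact absurd hv.symm huv
  · left
    obtain ⟨s1, s2, rfl⟩ := List.append_of_mem hv
    exact ⟨s, s1, s2, by simp⟩

lemma case_same' [DecidableEq V] {x y u v : V} {A B C L : List V}
    (h : Theta G x y A B C)
    (e : Ear G (x :: y :: (A ++ (B ++ C))) u v L)
    (hu : u = x ∨ u = y ∨ u ∈ A) (hv : v = x ∨ v = y ∨ v ∈ A) :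
    Outcome G (A.length + B.length + C.length + 2) := by
  have hu' : u ∈ x :: (A ++ [y]) := by simp; tauto
  have hv' : v ∈ x :: (A ++ [y]) := by simp; tauto
  rcases split_two hu' hv' e.huv with ⟨_, _, _, hd⟩ | ⟨_, _, _, hd⟩
  · exact case_same h e hd
  · exact case_same h e.symm hd

lemma case_adj [DecidableEq V] {x y u v : V} {A₂ B₁ B₂ C L : List V}
    (h : Theta G x y (u :: A₂) (B₁ ++ v :: B₂) C)
    (e : Ear G (x :: y :: ((u :: A₂) ++ ((B₁ ++ v :: B₂) ++ C))) u v L) :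
    ∃ m > (u :: A₂).length + (B₁ ++ v :: B₂).length + C.length + 2, Good G m := by
  have hL : 0 < L.length := List.length_pos_iff.2 e.ne
  have hn := e.nodup h.nd
  have hA : J G x [] u ∧ J G u A₂ y := J.split (L := []) h.hA
  have p1 : J G y (A₂.reverse ++ u :: L) v := hA.2.rev.glue e.path
  have p2 : J G y (C.reverse ++ x :: B₁) v := h.hC.rev.glue h.hB.split.1
  have p3 : J G y B₂.reverse v := h.hB.split.2.rev
  by_cases hB : B₂ = []
  · subst hB
    refine ⟨_, ?_, Or.inl ⟨y, (A₂.reverse ++ u :: L) ++ v :: (C.reverse ++ x :: B₁).reverse,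
      ⟨p1.glue p2.rev, nodup_of_count hn ?_⟩, rfl⟩⟩
    · simp; omega
    · intro b
      simp only [List.count_append, List.count_cons, List.count_nil, List.count_reverse]
      omega
  · refine ⟨_, ?_, Or.inr ⟨y, v, _, _, _, ⟨p1, p2, p3, by simp, by simp, by simpa using hB,
      nodup_of_count hn ?_⟩, rfl⟩⟩
    · simp; omega
    · intro b
      simp only [List.count_append, List.count_cons, List.count_reverse]
      omega

lemma case_diff [DecidableEq V] {x y u v : V} {A B C L : List V}
    (h : Theta G x y A B C)
    (e : Ear G (x :: y :: (A ++ (B ++ C))) u v L) (hu : u ∈ A) (hv : v ∈ B) :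
    Outcome G (A.length + B.length + C.length + 2) := by
  obtain ⟨A₁, A₂, rfl⟩ := List.append_of_mem hu
  obtain ⟨B₁, B₂, rfl⟩ := List.append_of_mem hv
  have hn := e.nodup h.nd
  by_cases hA₁ : A₁ = []
  · subst hA₁
    exact Or.inl (case_adj h e)
  by_cases hB₁ : B₁ = []
  · subst hB₁
    obtain ⟨m, hm, hg⟩ := case_adj h.swapAB (e.symm.congr (by simp; grind))
    exact Or.inl ⟨m, by simp at hm ⊢; omega, hg⟩
  by_cases hA₂ : A₂ = []
  · subst hA₂
    have h' := h.flip
    simp only [List.reverse_append, List.reverse_cons, List.reverse_nil, List.nil_append,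
      List.append_assoc, List.cons_append] at h'
    obtain ⟨m, hm, hg⟩ := case_adj h' (e.congr (by simp; grind))
    exact Or.inl ⟨m, by simp at hm ⊢; omega, hg⟩
  by_cases hB₂ : B₂ = []
  · subst hB₂
    have h' := h.swapAB.flip
    simp only [List.reverse_append, List.reverse_cons, List.reverse_nil, List.nil_append,
      List.append_assoc, List.cons_append] at h'
    obtain ⟨m, hm, hg⟩ := case_adj h' (e.symm.congr (by simp; grind))
    exact Or.inl ⟨m, by simp at hm ⊢; omega, hg⟩
  right
  refine minor_of_lists (R₁ := x :: (C ++ [y])) (R₂ := u :: (L ++ [v]))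
    (S := ![A₁, A₂.reverse, B₁, B₂.reverse])
    (a := ![x, y, x, y]) (b := ![u, u, v, v]) h.hC e.path ?_ ?_ ?_ ?_ (nodup_of_count hn ?_)
  · intro i; fin_cases i <;> simp
  · intro i; fin_cases i <;> simp
  · intro i; fin_cases i <;> simp [hA₁, hA₂, hB₁, hB₂]
  · intro i
    fin_cases i
    · exact h.hA.split.1
    · exact h.hA.split.2.rev
    · exact h.hB.split.1
    · exact h.hB.split.2.rev
  · intro b
    simp [List.count_cons]
    omega

lemma theta_step [DecidableEq V] {x y u v : V} {A B C L : List V}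
    (h : Theta G x y A B C)
    (e : Ear G (x :: y :: (A ++ (B ++ C))) u v L)
    (hu : u ∈ x :: y :: (A ++ (B ++ C))) (hv : v ∈ x :: y :: (A ++ (B ++ C))) :
    Outcome G (A.length + B.length + C.length + 2) := by
  have sameA := @case_same' V G _ x y u v A B C L h e
  have sameB := @case_same' V G _ x y u v B A C L h.swapAB (e.congr (by simp; grind))
  have sameC := @case_same' V G _ x y u v C A B L h.swapBC.swapAB (e.congr (by simp; grind))
  have dAB := @case_diff V G _ x y u v A B C L h e
  have dBA := @case_diff V G _ x y u v B A C L h.swapAB (e.congr (by simp; grind))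
  have dAC := @case_diff V G _ x y u v A C B L h.swapBC (e.congr (by simp; grind))
  have dCA := @case_diff V G _ x y u v C A B L h.swapBC.swapAB (e.congr (by simp; grind))
  have dBC := @case_diff V G _ x y u v B C A L h.swapAB.swapBC (e.congr (by simp; grind))
  have dCB := @case_diff V G _ x y u v C B A L h.swapAB.swapBC.swapAB
    (e.congr (by simp; grind))
  rw [show B.length + A.length + C.length + 2 = A.length + B.length + C.length + 2 by omega]
    at sameB dBA
  rw [show C.length + A.length + B.length + 2 = A.length + B.length + C.length + 2 by omega]
    at sameC dCA
  rw [show A.length + C.length + B.length + 2 = A.length + B.length + C.length + 2 by omega]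
    at dAC
  rw [show B.length + C.length + A.length + 2 = A.length + B.length + C.length + 2 by omega]
    at dBC
  rw [show C.length + B.length + A.length + 2 = A.length + B.length + C.length + 2 by omega]
    at dCB
  simp only [List.mem_append, List.mem_cons] at hu hv
  rcases hu with hu | hu | hu | hu | hu <;> rcases hv with hv | hv | hv | hv | hv <;>
    first
    | exact sameA (by simp [hu]) (by simp [hv])
    | exact sameB (by simp [hu]) (by simp [hv])
    | exact sameC (by simp [hu]) (by simp [hv])
    | exact dAB hu hv
    | exact dBA hu hv
    | exact dAC hu hv
    | exact dCA hu hv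
    | exact dBC hu hv
    | exact dCB hu hv

lemma exists_first {l : List V} (U : List V) (h : ∃ a ∈ l, a ∈ U) :
    ∃ L v R, l = L ++ v :: R ∧ v ∈ U ∧ ∀ a ∈ L, a ∉ U := by
  induction l with
  | nil => simp at h
  | cons a t ih =>
    by_cases ha : a ∈ U
    · exact ⟨[], a, t, rfl, ha, by simp⟩
    · obtain ⟨L, v, R, rfl, hv, hL⟩ := ih (by
        obtain ⟨b, hb, hbU⟩ := h
        rcases List.mem_cons.1 hb with rfl | hb
        · exact absurd hbU ha
        · exact ⟨b, hb, hbU⟩)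
      exact ⟨a :: L, v, R, rfl, hv, by simpa [ha] using hL⟩

lemma exists_ear [Fintype V] (h2 : KConnected 2 G) {l : List V} {a b w : V}
    (ha : a ∈ l) (hb : b ∈ l) (hab : a ≠ b) (hw : w ∉ l) :
    ∃ u v L, u ∈ l ∧ v ∈ l ∧ Ear G l u v L := by
  -- an edge leaving `l`
  have h0 := h2.2 ∅ (by simp)
  obtain ⟨p⟩ := h0.preconnected ⟨a, by simp⟩ ⟨w, by simp⟩
  obtain ⟨d, -, hd1, hd2⟩ := p.exists_boundary_dart {z | z.1 ∈ l} ha hw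
  obtain ⟨⟨⟨u, hu'⟩, ⟨z, hz'⟩⟩, hadj⟩ := d
  have hu : u ∈ l := hd1
  have hz : z ∉ l := hd2
  have huz : G.Adj u z := hadj
  obtain ⟨c, hc, hcu⟩ : ∃ c ∈ l, c ≠ u := by
    by_cases h : a = u
    · exact ⟨b, hb, by rw [← h]; exact hab.symm⟩
    · exact ⟨a, ha, h⟩
  have h1 := h2.2 {u} (by simp)
  have hzu : z ≠ u := huz.ne'
  obtain ⟨q, hq⟩ := h1.preconnected.exists_isPath ⟨z, by simpa using hzu⟩ ⟨c, by simpa using hcu⟩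
  have hqc : List.IsChain G.Adj (q.support.map Subtype.val) := by
    rw [List.isChain_map]
    exact q.isChain_adj_support
  have hqn : (q.support.map Subtype.val).Nodup :=
    hq.support_nodup.map Subtype.val_injective
  have hqu : u ∉ q.support.map Subtype.val := by
    simp
  obtain ⟨L, v, R, hdec, hv, hL⟩ := exists_first (l := q.support.map Subtype.val) l
    ⟨c, List.mem_map.2 ⟨_, q.end_mem_support, rfl⟩, hc⟩
  rw [hdec] at hqc hqn hqu
  rw [← q.cons_tail_support, List.map_cons] at hdec
  have hLne : L ≠ [] := by
    rintro rfl
    simp at hdec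
    exact hz (hdec.1 ▸ hv)
  obtain ⟨z', L', rfl⟩ := List.exists_cons_of_ne_nil hLne
  obtain rfl : z = z' := by
    simp at hdec
    exact hdec.1
  refine ⟨u, v, z :: L', hu, hv, ?_, hLne, hqn.of_append_left, hL, ?_⟩
  · have h3 := (List.isChain_split.1 hqc).1
    simp only [J, List.cons_append, List.isChain_cons_cons] at h3 ⊢
    exact ⟨huz, h3⟩
  · rintro rfl
    simp at hqu

lemma good_step [Fintype V] [DecidableEq V] (h2 : KConnected 2 G) {n : ℕ} (hg : Good G n)
    (hn : n < Fintype.card V) : Outcome G n := by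
  have out : ∀ l : List V, l.length < Fintype.card V → ∃ w, w ∉ l := by
    intro l hl
    by_contra hcon
    push Not at hcon
    have h1 : l.toFinset = Finset.univ := by
      ext a; simpa using hcon a
    have h3 := l.toFinset_card_le
    rw [h1, Finset.card_univ] at h3
    omega
  rcases hg with ⟨a, t, hc, rfl⟩ | ⟨x, y, A, B, C, ht, rfl⟩
  · obtain ⟨w, hw⟩ := out (a :: t) (by simpa using hn)
    have hne : t ≠ [] := by
      rintro rfl
      exact G.irrefl hc.1.adj
    obtain ⟨b, t', rfl⟩ := List.exists_cons_of_ne_nil hne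
    have hab : a ≠ b := by
      have := hc.2
      simp at this
      tauto
    obtain ⟨u, v, L, hu, hv, e⟩ := exists_ear h2 (a := a) (b := b) (by simp) (by simp) hab hw
    left
    rcases List.mem_cons.1 hu with rfl | hu
    · refine cyc_step hc e ?_
      rcases List.mem_cons.1 hv with rfl | hv
      · exact absurd rfl e.huv
      · exact hv
    · obtain ⟨s, r, hsr⟩ := List.append_of_mem hu
      rw [hsr] at hc e hv ⊢
      obtain ⟨m, hm, hg⟩ := cyc_step hc.rotate (e.congr (by simp; grind)) (v := v) (by
        have := e.huv
        simp at hv ⊢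
        grind)
      exact ⟨m, by simp at hm ⊢; omega, hg⟩
  · obtain ⟨w, hw⟩ := out (x :: y :: (A ++ (B ++ C))) (by simp; omega)
    have hxy : x ≠ y := by
      have := ht.nd
      simp at this
      tauto
    obtain ⟨u, v, L, hu, hv, e⟩ := exists_ear h2 (a := x) (b := y) (by simp) (by simp) hxy hw
    exact theta_step ht e hu hv

lemma good_ham [Fintype V] [DecidableEq V] {n : ℕ} (hg : Good G n)
    (hn : Fintype.card V ≤ n) : ∃ (u v : V) (p : G.Walk u v), p.IsHamiltonian := by
  have key : ∀ l : List V, List.IsChain G.Adj l → l.Nodup → l ≠ [] → Fintype.card V ≤ l.length →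
      ∃ (u v : V) (p : G.Walk u v), p.IsHamiltonian := by
    intro l hl hnd hne hcard
    obtain ⟨u, v, p, rfl⟩ := exists_walk hl hne
    refine ⟨u, v, p, ?_⟩
    have h1 : p.support.toFinset = Finset.univ := by
      apply Finset.eq_univ_of_card
      rw [List.toFinset_card_of_nodup hnd]
      exact le_antisymm hnd.length_le_card hcard
    intro a
    apply List.count_eq_one_of_mem hnd
    rw [← List.mem_toFinset, h1]
    simp
  rcases hg with ⟨a, t, hc, rfl⟩ | ⟨x, y, A, B, C, ht, rfl⟩
  · refine key (a :: t) ?_ hc.2 (by simp) (by simpa using hn)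
    have h1 : List.IsChain G.Adj ((a :: t) ++ [a]) := hc.1
    exact h1.left_of_append
  · refine key (A ++ y :: (B.reverse ++ x :: C)) ?_ (nodup_of_count ht.nd ?_) (by simp)
      (by simp; omega)
    · have h1 : J G x (A ++ y :: (B.reverse ++ x :: C)) y :=
        ht.hA.glue (ht.hB.rev.glue ht.hC)
      exact h1.inner
    · intro b
      simp only [List.count_append, List.count_cons, List.count_reverse]
      omega

lemma good_exists [Fintype V] (h2 : KConnected 2 G) : Good G 2 := by
  have h0 := h2.2 ∅ (by simp)
  have hc : 1 < Fintype.card V := by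
    have := h2.1
    rw [Nat.card_eq_fintype_card] at this
    omega
  obtain ⟨a, b, hab⟩ := Fintype.exists_pair_of_one_lt_card hc
  obtain ⟨p⟩ := h0.preconnected ⟨a, by simp⟩ ⟨b, by simp⟩
  obtain ⟨d, -, -, -⟩ := p.exists_boundary_dart {z | z.1 = a} rfl (by simpa using hab.symm)
  have hd : G.Adj d.fst.1 d.snd.1 := d.adj
  exact Or.inl ⟨d.fst.1, [d.snd.1], ⟨by simp [J, hd, hd.symm], by simp [hd.ne]⟩, rfl⟩

end Aux

/-- Corollary 21(iii): every 2-connected `K_{2,4}`-minor-free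
graph has a hamilton path. -/
theorem twoConnected_K24MinorFree_hamiltonPath {V : Type*} [Fintype V]
    [DecidableEq V] (G : SimpleGraph V) (h2 : KConnected 2 G)
    (hfree : MinorFree K24 G) :
    ∃ (u v : V) (p : G.Walk u v), p.IsHamiltonian := by
  have key : ∀ k n : ℕ, Good G n → Fintype.card V ≤ n + k → ∃ m, Good G m ∧ Fintype.card V ≤ m := by
    intro k
    induction k with
    | zero => exact fun n hg hn => ⟨n, hg, hn⟩
    | succ k ih =>
      intro n hg hn
      by_cases hlt : n < Fintype.card V
      · rcases good_step h2 hg hlt with ⟨m, hm, hgm⟩ | hminor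
        · exact ih m hgm (by omega)
        · exact absurd hminor hfree
      · exact ⟨n, hg, by omega⟩
  obtain ⟨m, hg, hm⟩ := key (Fintype.card V) 2 (good_exists h2) (by omega)
  exact good_ham hg hm

end K24Paper
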